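/- If there is a cover partition for a conjunctive query Q over a set 𝒱 of views consisting of cover descriptions (𝒜_1,V_1,α_1,ψ_1),…,(𝒜_m,V_m,α_m,ψ_m), then there is a consistent cover partition for Q over 𝒱 consisting of cover descriptions (𝒜_1,V_1,α'_1,ψ'_1),…,(𝒜_m,V_m,α'_m,ψ'_m) with the same partition sets 𝒜_i and the same views V_i. -/

import Mathlib

/-- A relational atom (or fact): a relation symbol with a list of arguments.
Arguments are natural numbers, serving both as variables and as data values. -/
structure Atom where
  rel : ℕ
  args : List ℕ
deriving DecidableEq

/-- Apply a substitution to an atom. -/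
def mapAtom (f : ℕ → ℕ) (A : Atom) : Atom := ⟨A.rel, A.args.map f⟩

/-- The variables of an atom. -/
def Atom.vars (A : Atom) : Finset ℕ := A.args.toFinset

/-- The variables of a finite set of atoms. -/
def varsOf (B : Finset Atom) : Finset ℕ := B.biUnion Atom.vars

/-- A conjunctive query: a head atom and a finite set of body atoms. -/
structure CQ where
  head : Atom
  body : Finset Atom
deriving DecidableEq

/-- All variables of a conjunctive query. -/
def CQ.vars (Q : CQ) : Finset ℕ := Q.head.vars ∪ varsOf Q.body

/-- A schema: a set of relation symbols together with an arity function. -/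
structure Schema where
  rels : Set ℕ
  ar : ℕ → ℕ

/-- An atom (or fact) over a schema. -/
def atomOver (σ : Schema) (A : Atom) : Prop :=
  A.rel ∈ σ.rels ∧ A.args.length = σ.ar A.rel

/-- `Q` is a (well-formed) conjunctive query over schema `σ`:
nonempty body of σ-atoms, head relation symbol not in σ, and safety. -/
def isCQ (σ : Schema) (Q : CQ) : Prop :=
  Q.body.Nonempty ∧ (∀ A ∈ Q.body, atomOver σ A) ∧
  Q.head.rel ∉ σ.rels ∧ Q.head.vars ⊆ varsOf Q.body

/-- A database is a set of facts (finiteness is imposed where needed). -/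
abbrev Database := Set Atom

/-- A database over a schema. -/
def isDBOver (σ : Schema) (D : Database) : Prop := ∀ F ∈ D, atomOver σ F

/-- The result of a conjunctive query on a database. -/
def evalCQ (Q : CQ) (D : Database) : Set Atom :=
  { F | ∃ ν : ℕ → ℕ, (∀ A ∈ Q.body, mapAtom ν A ∈ D) ∧ mapAtom ν Q.head = F }

/-- Containment of conjunctive queries. -/
def containedCQ (Q1 Q2 : CQ) : Prop :=
  ∀ D : Database, D.Finite → evalCQ Q1 D ⊆ evalCQ Q2 D

/-- Equivalence of conjunctive queries. -/
def equivCQ (Q1 Q2 : CQ) : Prop :=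
  ∀ D : Database, D.Finite → evalCQ Q1 D = evalCQ Q2 D

/-- A conjunctive query is minimal if no equivalent CQ has strictly fewer body atoms. -/
def isMinimal (Q : CQ) : Prop :=
  ∀ Q2 : CQ, equivCQ Q Q2 → Q.body.card ≤ Q2.body.card

/-- A homomorphism from `Q2` to `Q1`. -/
def isHom (h : ℕ → ℕ) (Q2 Q1 : CQ) : Prop :=
  (∀ A ∈ Q2.body, mapAtom h A ∈ Q1.body) ∧ mapAtom h Q2.head = Q1.head

/-- A body homomorphism from `Q2` to `Q1`. -/
def isBodyHom (h : ℕ → ℕ) (Q2 Q1 : CQ) : Prop :=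
  ∀ A ∈ Q2.body, mapAtom h A ∈ Q1.body

/-- A set of views over σ: each view is a CQ over σ and views have
pairwise distinct head relation symbols. -/
def isViewSet (σ : Schema) (𝒱 : Finset CQ) : Prop :=
  (∀ V ∈ 𝒱, isCQ σ V) ∧
  ∀ V ∈ 𝒱, ∀ W ∈ 𝒱, V ≠ W → V.head.rel ≠ W.head.rel

/-- The 𝒱-defined database 𝒱(D). -/
def viewDB (𝒱 : Finset CQ) (D : Database) : Database :=
  ⋃ V ∈ 𝒱, evalCQ V D

/-- `Q'` is a CQ over the schema σ_𝒱 of the head relations of the views 𝒱. -/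
def overViews (𝒱 : Finset CQ) (Q' : CQ) : Prop :=
  Q'.body.Nonempty ∧
  (∀ A ∈ Q'.body, ∃ V ∈ 𝒱, A.rel = V.head.rel ∧ A.args.length = V.head.args.length) ∧
  (∀ V ∈ 𝒱, Q'.head.rel ≠ V.head.rel) ∧
  Q'.head.vars ⊆ varsOf Q'.body

/-- `Q'` is a 𝒱-rewriting of `Q`: `Q'` is over σ_𝒱 and `Q'(𝒱(D)) = Q(D)`
for every (finite) database `D` over σ. -/
def isRewriting (σ : Schema) (𝒱 : Finset CQ) (Q Q' : CQ) : Prop :=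
  overViews 𝒱 Q' ∧
  ∀ D : Database, D.Finite → isDBOver σ D →
    evalCQ Q' (viewDB 𝒱 D) = evalCQ Q D

/-- `T` is a join tree for the atom set `B`. -/
def joinTreeProp (B : Finset Atom) (T : SimpleGraph {A : Atom // A ∈ B}) : Prop :=
  T.IsTree ∧
  ∀ (x : ℕ) (A A' : {A : Atom // A ∈ B}) (p : T.Walk A A'), p.IsPath →
    x ∈ A.1.vars → x ∈ A'.1.vars → ∀ C ∈ p.support, x ∈ C.1.vars

/-- The atom set `B` has a join tree. -/
def hasJoinTree (B : Finset Atom) : Prop :=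
  ∃ T : SimpleGraph {A : Atom // A ∈ B}, joinTreeProp B T

/-- A conjunctive query is acyclic if its body has a join tree. -/
def isAcyclicCQ (Q : CQ) : Prop := hasJoinTree Q.body

/-- A conjunctive query is free-connex acyclic. -/
def isFreeConnex (Q : CQ) : Prop :=
  isAcyclicCQ Q ∧ hasJoinTree (insert Q.head Q.body)

/-- The bridge variables of `𝒜 ⊆ body(Q)`. -/
def bvars (Q : CQ) (𝒜 : Finset Atom) : Finset ℕ :=
  varsOf 𝒜 ∩ (Q.head.vars ∪ varsOf (Q.body \ 𝒜))

/-- An application of a view `V`: a substitution that does not unify any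
quantified variable of `V` with another variable of `V`. -/
def isApplication (V : CQ) (α : ℕ → ℕ) : Prop :=
  ∀ x ∈ varsOf V.body, x ∉ V.head.vars →
    ∀ y ∈ CQ.vars V, y ≠ x → α x ≠ α y

/-- The query α(V). -/
def applyCQ (α : ℕ → ℕ) (V : CQ) : CQ :=
  ⟨mapAtom α V.head, V.body.image (mapAtom α)⟩

/-- `(𝒜, V, α, ψ)` is a cover description for `Q`. -/
def isCoverDesc (Q : CQ) (𝒜 : Finset Atom) (V : CQ) (α ψ : ℕ → ℕ) : Prop :=
  𝒜 ⊆ Q.body ∧ isApplication V α ∧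
  𝒜 ⊆ V.body.image (mapAtom α) ∧
  bvars Q 𝒜 ⊆ V.head.vars.image α ∧
  isBodyHom ψ (applyCQ α V) Q ∧
  ∀ x ∈ varsOf 𝒜, ψ x = x

/-- A cover partition for `Q` over `𝒱`: a collection of cover descriptions
whose atom sets partition `body(Q)`. -/
def isCoverPartition (Q : CQ) (𝒱 : Finset CQ) (m : ℕ)
    (𝒜 : Fin m → Finset Atom) (V : Fin m → CQ) (α ψ : Fin m → ℕ → ℕ) : Prop :=
  (∀ i, V i ∈ 𝒱 ∧ isCoverDesc Q (𝒜 i) (V i) (α i) (ψ i)) ∧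
  ∀ A ∈ Q.body, ∃! i, A ∈ 𝒜 i

/-- Consistency of a cover partition: a variable of any `α_j(V_j)` lies in the
range of another `α_i` only if it also lies in `bvars(𝒜_j)`. -/
def isConsistent (Q : CQ) (m : ℕ) (𝒜 : Fin m → Finset Atom) (V : Fin m → CQ)
    (α : Fin m → ℕ → ℕ) : Prop :=
  ∀ i j : Fin m, i ≠ j → ∀ z ∈ CQ.vars (applyCQ (α j) (V j)),
    (∃ x ∈ CQ.vars (V i), α i x = z) → z ∈ bvars Q (𝒜 j)

/-- The query `Q_𝒞` induced by a (consistent) cover partition. -/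
def inducedCQ (Q : CQ) (m : ℕ) (V : Fin m → CQ) (α : Fin m → ℕ → ℕ) : CQ :=
  ⟨Q.head, Finset.image (fun i => mapAtom (α i) (V i).head) Finset.univ⟩

/-- Quantified variable disjointness for a family of view applications. -/
def QVD (m : ℕ) (V : Fin m → CQ) (α : Fin m → ℕ → ℕ) : Prop :=
  ∀ i j : Fin m, i ≠ j → ∀ x ∈ varsOf (V i).body, x ∉ (V i).head.vars →
    ∀ y ∈ CQ.vars (V j), α i x ≠ α j y

/-- `QE` is an expansion of `Q'` with respect to the views `𝒱`. -/
def isExpansion (𝒱 : Finset CQ) (Q' QE : CQ) : Prop :=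
  ∃ (m : ℕ) (A' : Fin m → Atom) (V : Fin m → CQ) (α : Fin m → ℕ → ℕ),
    (∀ i, V i ∈ 𝒱 ∧ isApplication (V i) (α i) ∧ A' i = mapAtom (α i) (V i).head) ∧
    Q'.body = Finset.image A' Finset.univ ∧
    QVD m V α ∧
    QE.head = Q'.head ∧
    QE.body = Finset.biUnion Finset.univ (fun i => (V i).body.image (mapAtom (α i)))

/-- `atoms(x)`: the body atoms of `Q` containing the variable `x`. -/
def atomsWith (Q : CQ) (x : ℕ) : Finset Atom :=
  Q.body.filter (fun A => x ∈ A.vars)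

/-- Hierarchical conjunctive queries. -/
def isHierarchical (Q : CQ) : Prop :=
  ∀ x y : ℕ, atomsWith Q x ⊆ atomsWith Q y ∨ atomsWith Q y ⊆ atomsWith Q x ∨
    atomsWith Q x ∩ atomsWith Q y = ∅

/-- q-hierarchical conjunctive queries. -/
def isQHierarchical (Q : CQ) : Prop :=
  isHierarchical Q ∧ ∀ x y : ℕ, atomsWith Q x ⊂ atomsWith Q y →
    x ∈ Q.head.vars → y ∈ Q.head.vars

/-- `P` is a partition of `body(Q)` witnessing weak head arity at most `k`. -/
def witnessesWHA (Q : CQ) (k n : ℕ) (P : Fin n → Finset Atom) : Prop :=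
  (∀ i, (P i).Nonempty) ∧ (∀ i, P i ⊆ Q.body) ∧ (∀ A ∈ Q.body, ∃! i, A ∈ P i) ∧
  (∀ i, (varsOf (P i) ∩ Q.head.vars).card ≤ k) ∧
  (∀ i j, i ≠ j → ∀ x ∈ varsOf (P i), x ∈ varsOf (P j) → x ∈ Q.head.vars)

/-- `Q` has weak head arity at most `k`. -/
def hasWHAle (Q : CQ) (k : ℕ) : Prop := ∃ n P, witnessesWHA Q k n P

/-- The weak head arity of `Q`. -/
noncomputable def weakHeadArity (Q : CQ) : ℕ := sInf {k | hasWHAle Q k}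

/-- The cover graph of `Q`: vertices are the body atoms, with an edge between
two atoms iff they share a variable not occurring in the head. -/
def coverGraph (Q : CQ) : SimpleGraph {A : Atom // A ∈ Q.body} :=
  SimpleGraph.fromRel (fun A B => ∃ x, x ∈ A.1.vars ∧ x ∈ B.1.vars ∧ x ∉ Q.head.vars)

/-- A subset `s` of the atom set `B` is connected in the (join) tree `T`. -/
def connectedIn (B : Finset Atom) (T : SimpleGraph {A : Atom // A ∈ B}) (s : Finset Atom) : Prop :=
  (T.induce {A : {A : Atom // A ∈ B} | A.1 ∈ s}).Connected

theorem mapAtom_mapAtom (f g : ℕ → ℕ) (A : Atom) :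
    mapAtom f (mapAtom g A) = mapAtom (f ∘ g) A := by
  simp [mapAtom]

theorem mapAtom_eq_self {f : ℕ → ℕ} {A : Atom} (h : ∀ x ∈ A.vars, f x = x) :
    mapAtom f A = A := by
  obtain ⟨R, l⟩ := A
  simp only [mapAtom, Atom.mk.injEq, true_and]
  exact (List.map_congr_left fun x hx => h x (List.mem_toFinset.2 hx)).trans (List.map_id' l)

theorem mem_varsOf {B : Finset Atom} {x : ℕ} : x ∈ varsOf B ↔ ∃ A ∈ B, x ∈ A.vars := by
  simp [varsOf]

theorem varsOf_mono {B C : Finset Atom} (h : B ⊆ C) : varsOf B ⊆ varsOf C :=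
  Finset.biUnion_subset_biUnion_of_subset_left _ h

theorem mem_vars_mapAtom {f : ℕ → ℕ} {A : Atom} {z : ℕ} :
    z ∈ (mapAtom f A).vars ↔ ∃ x ∈ A.vars, f x = z := by
  simp [mapAtom, Atom.vars]

theorem exists_of_mem_vars_applyCQ {f : ℕ → ℕ} {V : CQ} {z : ℕ}
    (hz : z ∈ (applyCQ f V).vars) : ∃ x ∈ V.vars, f x = z := by
  rcases Finset.mem_union.1 hz with hz | hz
  · obtain ⟨x, hx, rfl⟩ := mem_vars_mapAtom.1 hz
    exact ⟨x, Finset.mem_union_left _ hx, rfl⟩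
  · obtain ⟨B, hB, hz⟩ := mem_varsOf.1 hz
    obtain ⟨A, hA, rfl⟩ := Finset.mem_image.1 hB
    obtain ⟨x, hx, rfl⟩ := mem_vars_mapAtom.1 hz
    exact ⟨x, Finset.mem_union_right _ (mem_varsOf.2 ⟨A, hA, hx⟩), rfl⟩

/-- Renaming a cover description injectively, fixing the covered variables, gives a cover
description. -/
theorem isCoverDesc.rename {Q V : CQ} {𝒜 : Finset Atom} {α ψ r s : ℕ → ℕ}
    (h : isCoverDesc Q 𝒜 V α ψ) (hs : Function.LeftInverse s r)
    (hr : ∀ x ∈ varsOf 𝒜, r x = x) : isCoverDesc Q 𝒜 V (r ∘ α) (ψ ∘ s) := by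
  obtain ⟨hsub, happ, hcov, hbv, hhom, hid⟩ := h
  refine ⟨hsub, fun x hx hxh y hy hne e => happ x hx hxh y hy hne (hs.injective e),
    fun A hA => ?_, fun x hx => ?_, fun A hA => ?_, fun x hx => ?_⟩
  · obtain ⟨B, hB, rfl⟩ := Finset.mem_image.1 (hcov hA)
    refine Finset.mem_image.2 ⟨B, hB, ?_⟩
    rw [← mapAtom_mapAtom]
    exact mapAtom_eq_self fun x hx => hr x (mem_varsOf.2 ⟨_, hA, hx⟩)
  · obtain ⟨y, hy, rfl⟩ := Finset.mem_image.1 (hbv hx)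
    exact Finset.mem_image.2 ⟨y, hy, hr _ (Finset.mem_inter.1 hx).1⟩
  · obtain ⟨B, hB, rfl⟩ := Finset.mem_image.1 hA
    have hB' := hhom (mapAtom α B) (Finset.mem_image_of_mem _ hB)
    rw [mapAtom_mapAtom] at hB' ⊢
    have e : (ψ ∘ s) ∘ (r ∘ α) = ψ ∘ α := funext fun x => congrArg ψ (hs (α x))
    rwa [e]
  · have e : s x = x := by conv_lhs => rw [← hr x hx, hs x]
    simp only [Function.comp_apply, e, hid x hx]

/-- Keep the variables in `S`, and send every other variable to one beyond `N` tagged by `i`. -/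
def freshen (N i : ℕ) (S : Finset ℕ) (z : ℕ) : ℕ :=
  if z ∈ S then z else N + Nat.pair i z

theorem freshen_of_mem {N i z : ℕ} {S : Finset ℕ} (hz : z ∈ S) : freshen N i S z = z :=
  if_pos hz

theorem freshen_injective {N : ℕ} (i : ℕ) {S : Finset ℕ} (hS : ∀ x ∈ S, x < N) :
    Function.Injective (freshen N i S) := by
  intro x y e
  unfold freshen at e
  split_ifs at e with hx hy hy
  · exact e
  · have := hS x hx; omega
  · have := hS y hy; omega
  · exact (Nat.pair_eq_pair.1 (Nat.add_left_cancel e)).2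

theorem mem_inter_of_freshen_eq {N i j x y : ℕ} {S T : Finset ℕ} (hS : ∀ x ∈ S, x < N)
    (hT : ∀ x ∈ T, x < N) (hij : i ≠ j) (e : freshen N i S x = freshen N j T y) :
    freshen N i S x ∈ S ∩ T := by
  unfold freshen at e ⊢
  split_ifs at e ⊢ with hx hy hy
  · exact Finset.mem_inter.2 ⟨hx, e ▸ hy⟩
  · have := hS x hx; omega
  · have := hT y hy; omega
  · exact absurd (Nat.pair_eq_pair.1 (Nat.add_left_cancel e)).1 hij

/-- From any cover partition for `Q` over `𝒱` one obtains a consistent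
cover partition with the same partition sets `𝒜_i` and the same views `V_i`. -/
theorem statement2 (σ : Schema) (Q : CQ) (𝒱 : Finset CQ)
    (hQ : isCQ σ Q) (h𝒱 : isViewSet σ 𝒱)
    (m : ℕ) (𝒜 : Fin m → Finset Atom) (V : Fin m → CQ) (α ψ : Fin m → ℕ → ℕ)
    (h : isCoverPartition Q 𝒱 m 𝒜 V α ψ) :
    ∃ α' ψ' : Fin m → ℕ → ℕ,
      isCoverPartition Q 𝒱 m 𝒜 V α' ψ' ∧ isConsistent Q m 𝒜 V α' := by
  obtain ⟨hdesc, hpart⟩ := h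
  set N := (varsOf Q.body).sup id + 1
  have hN (i : Fin m) : ∀ x ∈ varsOf (𝒜 i), x < N := fun x hx =>
    Nat.lt_succ_of_le (Finset.le_sup (f := id) (varsOf_mono (hdesc i).2.1 hx))
  let r (i : Fin m) : ℕ → ℕ := freshen N i (varsOf (𝒜 i))
  refine ⟨fun i => r i ∘ α i, fun i => ψ i ∘ Function.invFun (r i), ⟨fun i => ?_, hpart⟩, ?_⟩
  · exact ⟨(hdesc i).1, (hdesc i).2.rename
      (Function.leftInverse_invFun (freshen_injective _ (hN i))) fun x hx => freshen_of_mem hx⟩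
  · rintro i j hij z hz ⟨x, -, hxz⟩
    obtain ⟨y, -, rfl⟩ := exists_of_mem_vars_applyCQ hz
    obtain ⟨hzj, hzi⟩ := Finset.mem_inter.1
      (mem_inter_of_freshen_eq (hN j) (hN i) (Fin.val_ne_of_ne hij.symm) hxz.symm)
    obtain ⟨A, hA, hzA⟩ := mem_varsOf.1 hzi
    have hAQ := (hdesc i).2.1 hA
    refine Finset.mem_inter.2 ⟨hzj, Finset.mem_union_right _ (mem_varsOf.2 ⟨A, ?_, hzA⟩)⟩
    exact Finset.mem_sdiff.2 ⟨hAQ, fun hAj => hij ((hpart A hAQ).unique hA hAj)⟩
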